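/- For every integer m ≥ 1 and over any commutative ring, U_{2m−1}(x) + 1 = (−1)^{m−1} · A_{m−1}(−x) · A_m(x), where A_m(x) = U_m(x) + U_{m−1}(x). -/

import Mathlib

open Polynomial Polynomial.Chebyshev

theorem chebyshev_U_sq_sub_mul (R : Type*) [CommRing R] (n : ℤ) :
    U R n ^ 2 - U R (n + 1) * U R (n - 1) = 1 := by
  induction n using Int.induction_on with
  | zero => simp
  | succ k ih =>
    have h := U_add_one R (k + 1 : ℤ)
    have h' := U_add_one R (k : ℤ)
    rw [add_sub_cancel_right] at h ⊢
    linear_combination ih - U R (k : ℤ) * h + U R (k + 1 : ℤ) * h'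
  | pred k ih =>
    have h := U_sub_one R (-k - 1 : ℤ)
    have h' := U_sub_one R (-k : ℤ)
    rw [sub_add_cancel] at h ⊢
    linear_combination ih - U R (-k : ℤ) * h + U R (-k - 1 : ℤ) * h'

theorem chebyshev_U_two_mul_and_two_mul_add_one (R : Type*) [CommRing R] (n : ℕ) :
    U R (2 * n) = U R n ^ 2 - U R (n - 1) ^ 2 ∧
      U R (2 * n + 1) = U R n * (U R (n + 1) - U R (n - 1)) := by
  induction n with
  | zero => simp
  | succ k ih =>
    obtain ⟨even, odd⟩ := ih
    have h₁ := U_add_one R (k : ℤ)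
    have h₂ := U_add_one R (k + 1 : ℤ)
    have h₃ := U_add_one R (2 * k + 1 : ℤ)
    have h₄ := U_add_one R (2 * k + 1 + 1 : ℤ)
    rw [add_sub_cancel_right] at h₂ h₃ h₄
    have next_even : U R (2 * k + 1 + 1 : ℤ) = U R (k + 1 : ℤ) ^ 2 - U R (k : ℤ) ^ 2 := by
      linear_combination h₃ + 2 * X * odd - even -
        (U R (k + 1 : ℤ) - U R (k - 1 : ℤ)) * h₁
    push_cast
    rw [add_sub_cancel_right, show (2 * (k + 1) : ℤ) = 2 * k + 1 + 1 by ring]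
    refine ⟨next_even, ?_⟩
    linear_combination h₄ + 2 * X * next_even - odd - U R (k + 1 : ℤ) * h₂ + U R (k : ℤ) * h₁

theorem chebyshev_U_comp_neg_X (R : Type*) [CommRing R] (n : ℕ) :
    (U R n).comp (-X) = (-1) ^ n * U R n ∧
      (U R (n - 1)).comp (-X) = -(-1) ^ n * U R (n - 1) := by
  induction n with
  | zero => simp
  | succ k ih =>
    obtain ⟨h, h'⟩ := ih
    push_cast
    rw [add_sub_cancel_right, U_add_one]
    simp only [sub_comp, mul_comp, ofNat_comp, X_comp, h, h']
    constructor <;> ring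

/-- For every integer `m ≥ 1` and over any commutative ring,
`U (2m-1) + 1 = (-1)^(m-1) * A_{m-1}(-x) * A_m(x)`, where `A_m(x) = U_m(x) + U_{m-1}(x)`. -/
theorem chebyshev_U_odd_add_one_factorization (R : Type*) [CommRing R] (m : ℕ) (hm : 1 ≤ m) :
    U R (2 * m - 1) + 1 =
      (-1) ^ (m - 1) * ((U R ((m : ℤ) - 1) + U R ((m : ℤ) - 2)).comp (-X)) *
        (U R m + U R ((m : ℤ) - 1)) := by
  obtain ⟨k, rfl⟩ := Nat.exists_eq_add_of_le' hm
  obtain ⟨h, h'⟩ := chebyshev_U_comp_neg_X R k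
  have sign : ((-1) ^ k * (-1) ^ k : R[X]) = 1 := by rw [← mul_pow]; simp
  push_cast
  rw [show (2 * (k + 1) - 1 : ℤ) = 2 * k + 1 by ring, show (k + 1 - 2 : ℤ) = k - 1 by ring,
    add_sub_cancel_right, add_comp, h, h']
  linear_combination (chebyshev_U_two_mul_and_two_mul_add_one R k).2 -
    chebyshev_U_sq_sub_mul R k -
    (U R (k : ℤ) - U R (k - 1 : ℤ)) * (U R (k + 1 : ℤ) + U R (k : ℤ)) * sign
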